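/- Let γ : ℝ → ℝ be measurable with γ(ξ) > 0 for all ξ, satisfying ∫_ℝ 1/γ(ξ) dξ < ∞, and suppose there is a constant C > 0 such that √(γ(ξ)) ≤ C (√(γ(ξ − η)) + √(γ(η))) for all ξ, η ∈ ℝ. Then there exists a constant C̃ > 0, depending only on C and ∫_ℝ dξ/γ(ξ), such that for all Schwartz functions u, v : ℝ → ℂ, |uv|_γ ≤ C̃ |u|_γ |v|_γ (i.e., the space H_γ is an algebra under pointwise multiplication). -/

import Mathlib

open MeasureTheory

/-- Fourier transform with the convention `û(ξ) = ∫ u(x) e^{-iξx} dx`. -/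
noncomputable def FT (u : ℝ → ℂ) (ξ : ℝ) : ℂ :=
  ∫ x : ℝ, u x * Complex.exp (-(Complex.I * (ξ : ℂ) * (x : ℂ)))

section QuasiSubadditive

variable {w : ℝ → ℝ} {C : ℝ}

/-- A measurable quasi-subadditive function is bounded above near the origin. -/
lemma exists_bound_of_quasi_subadditive (hw : Measurable w) (hC : 0 < C)
    (hsub : ∀ ξ η, w ξ ≤ C * (w (ξ - η) + w η)) :
    ∃ M, ∀ ξ, |ξ| ≤ 1 → w ξ ≤ M := by
  set S : ℕ → Set ℝ := fun n => Set.Icc (-2) 2 ∩ {x | (n : ℝ) < w x} with hS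
  have hSm : ∀ n, MeasurableSet (S n) := fun n =>
    measurableSet_Icc.inter (measurableSet_lt measurable_const hw)
  have hanti : Antitone S := fun m n hmn x hx =>
    ⟨hx.1, lt_of_le_of_lt (by exact_mod_cast hmn : (m : ℝ) ≤ n) hx.2⟩
  have hfin : volume (S 0) ≠ ⊤ :=
    ((measure_mono Set.inter_subset_left).trans_lt
      (by simp : volume (Set.Icc (-2 : ℝ) 2) < ⊤)).ne
  have hlim := tendsto_measure_iInter_atTop (μ := volume)
    (fun n => (hSm n).nullMeasurableSet) hanti ⟨0, hfin⟩
  have hempty : ⋂ n, S n = ∅ := by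
    refine Set.eq_empty_of_forall_notMem fun x hx => ?_
    obtain ⟨n, hn⟩ := exists_nat_ge (w x)
    exact absurd (Set.mem_iInter.1 hx n).2 (not_lt.2 hn)
  rw [hempty, measure_empty] at hlim
  obtain ⟨n, hn⟩ := (hlim.eventually_lt_const (zero_lt_one)).exists
  refine ⟨C * (n + n), fun ξ hξ => ?_⟩
  obtain ⟨hξ1, hξ2⟩ := abs_le.1 hξ
  by_contra! hlt
  have hcover : Set.Icc (-1 : ℝ) 1 ⊆ S n ∪ (fun η => ξ - η) ⁻¹' S n := by
    intro η hη
    by_contra hnot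
    simp only [Set.mem_union, not_or, hS, Set.mem_inter_iff, Set.mem_preimage, Set.mem_Icc,
      Set.mem_ofPred_eq, not_and, not_lt] at hnot
    have h1 := hnot.1 ⟨by linarith [hη.1], by linarith [hη.2]⟩
    have h2 := hnot.2 ⟨by linarith [hη.2], by linarith [hη.1]⟩
    exact absurd (hsub ξ η) (not_le.2 (lt_of_le_of_lt (by gcongr) hlt))
  have hpre : volume ((fun η => ξ - η) ⁻¹' S n) = volume (S n) :=
    (Measure.measurePreserving_sub_left volume ξ).measure_preimage (hSm n).nullMeasurableSet
  have h2 : volume (Set.Icc (-1 : ℝ) 1) < 1 + 1 :=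
    ((measure_mono hcover).trans (measure_union_le _ _)).trans_lt
      (by rw [hpre]; exact ENNReal.add_lt_add hn hn)
  rw [Real.volume_Icc] at h2
  norm_num at h2

/-- A measurable quasi-subadditive function grows at most polynomially. -/
lemma exists_polynomial_bound_of_quasi_subadditive (hw : Measurable w) (hC : 0 < C)
    (hsub : ∀ ξ η, w ξ ≤ C * (w (ξ - η) + w η)) :
    ∃ (M : ℝ) (k : ℕ), 0 ≤ M ∧ ∀ ξ, w ξ ≤ M * (1 + |ξ|) ^ k := by
  obtain ⟨M, hM⟩ := exists_bound_of_quasi_subadditive hw hC hsub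
  obtain ⟨k, hk⟩ := exists_pow_lt_of_lt_one (by positivity : 0 < 1 / (2 * C))
    (by norm_num : (3 / 4 : ℝ) < 1)
  have hk' : 2 * C * (3 / 4) ^ k ≤ 1 := by
    rw [lt_div_iff₀ (by positivity)] at hk
    linarith
  have key : ∀ n : ℕ, ∀ ξ : ℝ, |ξ| ≤ 2 ^ n → w ξ ≤ max M 0 * (1 + |ξ|) ^ k := by
    intro n
    induction n with
    | zero =>
      intro ξ hξ
      have h1 : (1 : ℝ) ≤ (1 + |ξ|) ^ k := one_le_pow₀ (by linarith [abs_nonneg ξ])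
      calc w ξ ≤ max M 0 := (hM ξ (by simpa using hξ)).trans (le_max_left _ _)
        _ ≤ _ := le_mul_of_one_le_right (le_max_right _ _) h1
    | succ n ih =>
      intro ξ hξ
      rcases le_or_gt |ξ| 1 with h | h
      · have h1 : (1 : ℝ) ≤ (1 + |ξ|) ^ k := one_le_pow₀ (by linarith [abs_nonneg ξ])
        calc w ξ ≤ max M 0 := (hM ξ h).trans (le_max_left _ _)
          _ ≤ _ := le_mul_of_one_le_right (le_max_right _ _) h1
      · have habs : |ξ / 2| = |ξ| / 2 := by rw [abs_div, abs_two]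
        have hhalf := ih (ξ / 2) (by rw [habs]; rw [pow_succ] at hξ; linarith)
        have hpow : (1 + |ξ / 2|) ^ k ≤ (3 / 4) ^ k * (1 + |ξ|) ^ k := by
          rw [← mul_pow, habs]
          exact pow_le_pow_left₀ (by positivity) (by linarith) k
        have hs := hsub ξ (ξ / 2)
        rw [sub_half] at hs
        calc w ξ ≤ 2 * C * w (ξ / 2) := by linarith
          _ ≤ 2 * C * (max M 0 * ((3 / 4) ^ k * (1 + |ξ|) ^ k)) := by
            gcongr
            exact hhalf.trans (by gcongr)
          _ = 2 * C * (3 / 4) ^ k * (max M 0 * (1 + |ξ|) ^ k) := by ring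
          _ ≤ 1 * (max M 0 * (1 + |ξ|) ^ k) := by gcongr
          _ = _ := one_mul _
  refine ⟨max M 0, k, le_max_right _ _, fun ξ => ?_⟩
  obtain ⟨n, hn⟩ := pow_unbounded_of_one_lt |ξ| (one_lt_two)
  exact key n ξ hn.le

end QuasiSubadditive

/-- Schwartz functions are square integrable against weights of polynomial growth. -/
lemma SchwartzMap.integrable_mul_norm_sq_of_polynomial_bound {γ : ℝ → ℝ} (hγ : Measurable γ)
    (hγ0 : ∀ ξ, 0 ≤ γ ξ) {M : ℝ} {k : ℕ} (hb : ∀ ξ, γ ξ ≤ M * (1 + |ξ|) ^ k)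
    (U : SchwartzMap ℝ ℂ) : Integrable fun ξ => γ ξ * ‖U ξ‖ ^ 2 := by
  have hint : Integrable fun ξ => M * ‖(1 + |ξ|) ^ k * ‖U ξ‖‖ * ‖U ξ‖ := by
    have h1 : Integrable fun ξ : ℝ => (1 + |ξ|) ^ k * ‖U ξ‖ := by
      simp_rw [add_pow, one_pow, one_mul, Finset.sum_mul]
      refine integrable_finsetSum _ fun i _ => ?_
      have := (U.integrable_pow_mul volume (k - i)).const_mul ((k.choose i : ℝ))
      refine this.congr (Filter.Eventually.of_forall fun x => ?_)
      simp only [Real.norm_eq_abs]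
      ring
    refine (h1.norm.const_mul M).mul_bdd (c := SchwartzMap.seminorm ℝ 0 0 U)
      U.continuous.norm.aestronglyMeasurable (Filter.Eventually.of_forall fun x => ?_)
    simpa using SchwartzMap.norm_le_seminorm ℝ U x
  refine hint.mono' (hγ.mul (U.continuous.norm.measurable.pow_const 2)).aestronglyMeasurable
    (Filter.Eventually.of_forall fun ξ => ?_)
  have h0 : 0 ≤ (1 + |ξ|) ^ k * ‖U ξ‖ := by positivity
  rw [Real.norm_of_nonneg (mul_nonneg (hγ0 ξ) (by positivity)), Real.norm_of_nonneg h0]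
  calc γ ξ * ‖U ξ‖ ^ 2 ≤ M * (1 + |ξ|) ^ k * ‖U ξ‖ ^ 2 := by gcongr; exact hb ξ
    _ = _ := by ring

open scoped FourierTransform

lemma FT_eq_fourier (u : ℝ → ℂ) (ξ : ℝ) : FT u ξ = 𝓕 u (ξ / (2 * Real.pi)) := by
  rw [Real.fourier_real_eq_integral_exp_smul, FT]
  refine integral_congr_ae (Filter.Eventually.of_forall fun x => ?_)
  simp only [smul_eq_mul]
  rw [mul_comm]
  congr 2
  have : (Real.pi : ℂ) ≠ 0 := by exact_mod_cast Real.pi_ne_zero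
  push_cast
  field_simp

lemma exists_schwartzMap_eq_FT (u : SchwartzMap ℝ ℂ) :
    ∃ U : SchwartzMap ℝ ℂ, ∀ ξ, U ξ = FT u ξ := by
  refine ⟨SchwartzMap.compCLMOfContinuousLinearEquiv ℝ
    (ContinuousLinearEquiv.unitsEquivAut ℝ (Units.mk0 (2 * Real.pi)⁻¹ (by positivity))) (𝓕 u),
    fun ξ => ?_⟩
  rw [FT_eq_fourier, ← SchwartzMap.fourier_coe]
  simp [div_eq_mul_inv]

open scoped Convolution in
lemma SchwartzMap.fourier_mul_eq_integral (u v : SchwartzMap ℝ ℂ) (x : ℝ) :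
    𝓕 (fun y => u y * v y) x = ∫ t, 𝓕 (u : ℝ → ℂ) t * 𝓕 (v : ℝ → ℂ) (x - t) := by
  have h := SchwartzMap.convolution_apply (ContinuousLinearMap.mul ℂ ℂ) (𝓕⁻ u) (𝓕⁻ v) (-x)
  have hL : SchwartzMap.convolution (ContinuousLinearMap.mul ℂ ℂ) (𝓕⁻ u) (𝓕⁻ v)
      = 𝓕⁻ (SchwartzMap.pairing (ContinuousLinearMap.mul ℂ ℂ) u v) := by
    rw [← FourierTransform.fourierInv_fourier_eq (F := SchwartzMap ℝ ℂ)
      (SchwartzMap.convolution (ContinuousLinearMap.mul ℂ ℂ) (𝓕⁻ u) (𝓕⁻ v)),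
      SchwartzMap.fourier_convolution]
    simp
  rw [hL, SchwartzMap.fourierInv_coe, Real.fourierInv_eq_fourier_neg, neg_neg] at h
  have hp : (⇑(SchwartzMap.pairing (ContinuousLinearMap.mul ℂ ℂ) u v) : ℝ → ℂ)
      = fun y => u y * v y := by
    ext y
    simp [SchwartzMap.pairing_apply_apply]
  rw [hp] at h
  rw [h, convolution_def, ← integral_neg_eq_self]
  refine integral_congr_ae (Filter.Eventually.of_forall fun t => ?_)
  simp only [SchwartzMap.fourierInv_coe, Real.fourierInv_eq_fourier_neg,
    ContinuousLinearMap.mul_apply', neg_neg]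
  congr 2
  ring_nf

lemma FT_mul_eq_integral (u v : SchwartzMap ℝ ℂ) (ξ : ℝ) :
    FT (fun y => u y * v y) ξ = (2 * Real.pi)⁻¹ * ∫ η, FT u η * FT v (ξ - η) := by
  have hpi : (2 * Real.pi : ℝ) ≠ 0 := by positivity
  rw [FT_eq_fourier, SchwartzMap.fourier_mul_eq_integral]
  have h := Measure.integral_comp_mul_left (fun η => FT u η * FT v (ξ - η)) (2 * Real.pi)
  rw [abs_of_pos (by positivity), Complex.real_smul] at h
  push_cast at h ⊢
  rw [← h]
  refine integral_congr_ae (Filter.Eventually.of_forall fun t => ?_)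
  simp only [FT_eq_fourier]
  congr 2 <;> field_simp

/-- The Cauchy-Schwarz inequality for the lower Lebesgue integral, in squared form. -/
lemma lintegral_mul_sq_le {α : Type*} [MeasurableSpace α] {μ : Measure α} {f g : α → ENNReal}
    (hf : AEMeasurable f μ) (hg : AEMeasurable g μ) :
    (∫⁻ a, f a * g a ∂μ) ^ 2 ≤ (∫⁻ a, f a ^ 2 ∂μ) * ∫⁻ a, g a ^ 2 ∂μ := by
  have h := ENNReal.lintegral_mul_le_Lp_mul_Lq μ Real.HolderConjugate.two_two hf hg
  simp only [Pi.mul_apply, ENNReal.rpow_two] at h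
  calc _ ≤ ((∫⁻ a, f a ^ 2 ∂μ) ^ (1 / 2 : ℝ) * (∫⁻ a, g a ^ 2 ∂μ) ^ (1 / 2 : ℝ)) ^ 2 := by
        gcongr
    _ = _ := by
      rw [mul_pow, ← ENNReal.rpow_two, ← ENNReal.rpow_two, ← ENNReal.rpow_mul, ← ENNReal.rpow_mul]
      norm_num

/-- Pointwise form of the algebra estimate: if `c` is dominated by a multiple of the convolution
of `a` and `b`, then `γ c²` is dominated by the convolution of `γ a²` and `γ b²`. -/
lemma weighted_convolution_pointwise {γ : ℝ → ℝ} {C J K : ℝ} (hC : 0 < C) (hK : 0 ≤ K)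
    (hγ : Measurable γ) (hpos : ∀ ξ, 0 < γ ξ) (hint : Integrable fun ξ => 1 / γ ξ)
    (hJ : ∫ ξ, 1 / γ ξ = J)
    (hsub : ∀ ξ η, √(γ ξ) ≤ C * (√(γ (ξ - η)) + √(γ η)))
    {a b : ℝ → ℝ} (ha : Measurable a) (hb : Measurable b) (ha0 : ∀ η, 0 ≤ a η)
    (hb0 : ∀ η, 0 ≤ b η) {c : ℝ} (ξ : ℝ)
    (hc0 : 0 ≤ c)
    (hc : ENNReal.ofReal c ≤ ENNReal.ofReal K * ∫⁻ η, ENNReal.ofReal (a η * b (ξ - η))) :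
    ENNReal.ofReal (γ ξ * c ^ 2) ≤ ENNReal.ofReal ((K * C) ^ 2 * (4 * J)) *
      ∫⁻ η, ENNReal.ofReal (γ η * a η ^ 2) * ENNReal.ofReal (γ (ξ - η) * b (ξ - η) ^ 2) := by
  have hspos : ∀ η, 0 < √(γ η) := fun η => Real.sqrt_pos.2 (hpos η)
  set P : ℝ → ℝ := fun η => 1 / √(γ (ξ - η)) + 1 / √(γ η)
  set Q : ℝ → ℝ := fun η => √(γ η) * a η * (√(γ (ξ - η)) * b (ξ - η))
  have hQ0 : ∀ η, 0 ≤ Q η := fun η =>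
    mul_nonneg (mul_nonneg (hspos _).le (ha0 _)) (mul_nonneg (hspos _).le (hb0 _))
  have hP0 : ∀ η, 0 ≤ P η := fun η =>
    add_nonneg (one_div_nonneg.2 (hspos _).le) (one_div_nonneg.2 (hspos _).le)
  have hPm : Measurable P := by fun_prop
  have hQm : Measurable Q := by fun_prop
  have hpt : ENNReal.ofReal (√(γ ξ) * c) ≤
      ENNReal.ofReal (K * C) * ∫⁻ η, ENNReal.ofReal (P η) * ENNReal.ofReal (Q η) := by
    rw [ENNReal.ofReal_mul (hspos ξ).le, ENNReal.ofReal_mul hK]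
    refine (mul_le_mul_right hc _).trans ?_
    rw [mul_left_comm, mul_assoc]
    refine mul_le_mul_right ?_ _
    rw [← lintegral_const_mul' _ _ ENNReal.ofReal_ne_top,
      ← lintegral_const_mul' _ _ ENNReal.ofReal_ne_top]
    refine lintegral_mono fun η => ?_
    rw [← ENNReal.ofReal_mul (hspos ξ).le, ← ENNReal.ofReal_mul (hP0 η),
      ← ENNReal.ofReal_mul hC.le]
    refine ENNReal.ofReal_le_ofReal ?_
    have hPQ : P η * Q η = (√(γ (ξ - η)) + √(γ η)) * (a η * b (ξ - η)) := by
      have h1 := (hspos η).ne'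
      have h2 := (hspos (ξ - η)).ne'
      simp only [P, Q]
      field_simp
      ring
    rw [hPQ, ← mul_assoc C]
    exact mul_le_mul_of_nonneg_right (hsub ξ η) (mul_nonneg (ha0 _) (hb0 _))
  have hPint : ∫⁻ η, ENNReal.ofReal (P η) ^ 2 ≤ ENNReal.ofReal (4 * J) := by
    have hint' : Integrable fun η => 1 / γ (ξ - η) := hint.comp_sub_left ξ
    have heq : ∫ η, 2 * (1 / γ (ξ - η) + 1 / γ η) = 4 * J := by
      rw [integral_const_mul, integral_add hint' hint,
        integral_sub_left_eq_self (fun η => 1 / γ η) volume ξ, hJ]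
      ring
    have hint2 : Integrable fun η => 2 * (1 / γ (ξ - η) + 1 / γ η) :=
      (hint'.add hint).const_mul 2
    rw [← heq, ofReal_integral_eq_lintegral_ofReal hint2
      (Filter.Eventually.of_forall fun η => mul_nonneg zero_le_two
        (add_nonneg (one_div_nonneg.2 (hpos _).le) (one_div_nonneg.2 (hpos _).le)))]
    gcongr with η
    rw [← ENNReal.ofReal_pow (hP0 η)]
    refine ENNReal.ofReal_le_ofReal ?_
    refine (add_sq_le (a := 1 / √(γ (ξ - η))) (b := 1 / √(γ η))).trans_eq ?_
    rw [div_pow, div_pow, Real.sq_sqrt (hpos _).le, Real.sq_sqrt (hpos _).le, one_pow]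
  have hQsq : ∀ η, ENNReal.ofReal (Q η) ^ 2 =
      ENNReal.ofReal (γ η * a η ^ 2) * ENNReal.ofReal (γ (ξ - η) * b (ξ - η) ^ 2) := by
    intro η
    rw [← ENNReal.ofReal_pow (hQ0 η),
      ← ENNReal.ofReal_mul (mul_nonneg (hpos η).le (sq_nonneg _))]
    simp only [Q, mul_pow, Real.sq_sqrt (hpos _).le]
  simp_rw [← hQsq]
  calc ENNReal.ofReal (γ ξ * c ^ 2) = ENNReal.ofReal (√(γ ξ) * c) ^ 2 := by
        rw [← ENNReal.ofReal_pow (mul_nonneg (hspos ξ).le hc0), mul_pow,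
          Real.sq_sqrt (hpos ξ).le]
    _ ≤ (ENNReal.ofReal (K * C) *
          ∫⁻ η, ENNReal.ofReal (P η) * ENNReal.ofReal (Q η)) ^ 2 := by gcongr
    _ ≤ ENNReal.ofReal (K * C) ^ 2 *
          ((∫⁻ η, ENNReal.ofReal (P η) ^ 2) * ∫⁻ η, ENNReal.ofReal (Q η) ^ 2) := by
        rw [mul_pow]
        gcongr
        exact lintegral_mul_sq_le hPm.ennreal_ofReal.aemeasurable hQm.ennreal_ofReal.aemeasurable
    _ ≤ ENNReal.ofReal (K * C) ^ 2 *
          (ENNReal.ofReal (4 * J) * ∫⁻ η, ENNReal.ofReal (Q η) ^ 2) := by gcongr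
    _ = _ := by
        rw [ENNReal.ofReal_mul (sq_nonneg _), ENNReal.ofReal_pow (mul_nonneg hK hC.le), mul_assoc]

/-- Tonelli: the convolution of two nonnegative functions has integral the product of the
integrals. -/
lemma lintegral_lintegral_mul_sub {f g : ℝ → ENNReal} (hf : Measurable f) (hg : Measurable g) :
    ∫⁻ ξ, ∫⁻ η, f η * g (ξ - η) = (∫⁻ η, f η) * ∫⁻ η, g η := by
  rw [lintegral_lintegral_swap (by fun_prop)]
  have h : ∀ η, ∫⁻ ξ, f η * g (ξ - η) = f η * ∫⁻ ξ, g ξ := fun η => by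
    rw [lintegral_const_mul _ (by fun_prop), lintegral_sub_right_eq_self g η]
  simp_rw [h]
  rw [lintegral_mul_const _ hf]

/-- If `γ > 0`, `∫ 1/γ = J < ∞` and `√γ` is subadditive up to the constant `C`, then there is a
constant `C̃ > 0` depending only on `C` and `J` such that `|uv|_γ ≤ C̃ |u|_γ |v|_γ` for all
Schwartz `u, v`: the space `H_γ` is an algebra under pointwise multiplication. -/
theorem stmt_4 (C J : ℝ) (hC : 0 < C) (hJ : 0 < J) :
    ∃ Ct : ℝ, 0 < Ct ∧
      ∀ γ : ℝ → ℝ, Measurable γ → (∀ ξ : ℝ, 0 < γ ξ) →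
        Integrable (fun ξ : ℝ => 1 / γ ξ) → (∫ ξ : ℝ, 1 / γ ξ) = J →
        (∀ ξ η : ℝ, Real.sqrt (γ ξ) ≤ C * (Real.sqrt (γ (ξ - η)) + Real.sqrt (γ η))) →
        ∀ u v : SchwartzMap ℝ ℂ,
          Real.sqrt (∫ ξ : ℝ, γ ξ * ‖FT (fun x => u x * v x) ξ‖ ^ 2) ≤
            Ct * Real.sqrt (∫ ξ : ℝ, γ ξ * ‖FT (⇑u) ξ‖ ^ 2) *
              Real.sqrt (∫ ξ : ℝ, γ ξ * ‖FT (⇑v) ξ‖ ^ 2) := by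
  refine ⟨√(((2 * Real.pi)⁻¹ * C) ^ 2 * (4 * J)), by positivity, ?_⟩
  intro γ hγ hpos hint hJeq hsub u v
  obtain ⟨M, k, hM, hgrowth⟩ :=
    exists_polynomial_bound_of_quasi_subadditive (w := fun ξ => √(γ ξ)) hγ.sqrt hC hsub
  have hγb : ∀ ξ, γ ξ ≤ M ^ 2 * (1 + |ξ|) ^ (k * 2) := fun ξ => by
    rw [← Real.sq_sqrt (hpos ξ).le, pow_mul, ← mul_pow]
    exact pow_le_pow_left₀ (Real.sqrt_nonneg _) (hgrowth ξ) 2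
  have hFT : ∀ f : SchwartzMap ℝ ℂ, Measurable (fun ξ => ‖FT f ξ‖) ∧
      Integrable fun ξ => γ ξ * ‖FT f ξ‖ ^ 2 := fun f => by
    obtain ⟨F, hF⟩ := exists_schwartzMap_eq_FT f
    simp_rw [← hF]
    exact ⟨F.continuous.norm.measurable,
      F.integrable_mul_norm_sq_of_polynomial_bound hγ (fun ξ => (hpos ξ).le) hγb⟩
  obtain ⟨hum, hui⟩ := hFT u
  obtain ⟨hvm, hvi⟩ := hFT v
  have hnonneg : ∀ (f : ℝ → ℂ) ξ, 0 ≤ γ ξ * ‖FT f ξ‖ ^ 2 := fun f ξ =>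
    mul_nonneg (hpos ξ).le (sq_nonneg _)
  have hconv : ∀ ξ, ENNReal.ofReal ‖FT (fun x => u x * v x) ξ‖ ≤
      ENNReal.ofReal (2 * Real.pi)⁻¹ * ∫⁻ η, ENNReal.ofReal (‖FT u η‖ * ‖FT v (ξ - η)‖) := by
    intro ξ
    rw [FT_mul_eq_integral, norm_mul, ENNReal.ofReal_mul (norm_nonneg _), Complex.norm_real,
      Real.norm_of_nonneg (by positivity)]
    gcongr
    rw [ofReal_norm]
    refine (enorm_integral_le_lintegral_enorm _).trans_eq ?_
    simp_rw [← ofReal_norm, norm_mul]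
  have hmain : ∫⁻ ξ, ENNReal.ofReal (γ ξ * ‖FT (fun x => u x * v x) ξ‖ ^ 2) ≤
      ENNReal.ofReal (((2 * Real.pi)⁻¹ * C) ^ 2 * (4 * J)) *
        ((∫⁻ ξ, ENNReal.ofReal (γ ξ * ‖FT u ξ‖ ^ 2)) *
          ∫⁻ ξ, ENNReal.ofReal (γ ξ * ‖FT v ξ‖ ^ 2)) := by
    rw [← lintegral_lintegral_mul_sub (by fun_prop) (by fun_prop),
      ← lintegral_const_mul' _ _ ENNReal.ofReal_ne_top]
    exact lintegral_mono fun ξ => weighted_convolution_pointwise hC (by positivity) hγ hpos hint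
      hJeq hsub hum hvm (fun _ => norm_nonneg _) (fun _ => norm_nonneg _) ξ (norm_nonneg _)
      (hconv ξ)
  rw [← ofReal_integral_eq_lintegral_ofReal hui (Filter.Eventually.of_forall (hnonneg u)),
    ← ofReal_integral_eq_lintegral_ofReal hvi (Filter.Eventually.of_forall (hnonneg v)),
    ← ENNReal.ofReal_mul (integral_nonneg (hnonneg u)),
    ← ENNReal.ofReal_mul (by positivity)] at hmain
  rw [← Real.sqrt_mul (by positivity),
    ← Real.sqrt_mul (mul_nonneg (by positivity) (integral_nonneg (hnonneg u)))]
  refine Real.sqrt_le_sqrt ?_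
  rw [mul_assoc]
  have hR : 0 ≤ ((2 * Real.pi)⁻¹ * C) ^ 2 * (4 * J) *
      ((∫ ξ, γ ξ * ‖FT u ξ‖ ^ 2) * ∫ ξ, γ ξ * ‖FT v ξ‖ ^ 2) :=
    mul_nonneg (by positivity)
      (mul_nonneg (integral_nonneg (hnonneg u)) (integral_nonneg (hnonneg v)))
  by_cases hi : Integrable fun ξ => γ ξ * ‖FT (fun x => u x * v x) ξ‖ ^ 2
  · rw [← ofReal_integral_eq_lintegral_ofReal hi (Filter.Eventually.of_forall (hnonneg _))]
      at hmain
    exact (ENNReal.ofReal_le_ofReal_iff hR).1 hmain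
  · rw [integral_undef hi]
    exact hR
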